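/- arXiv:math/0206169 — 2 statements merged into one kernel-verified Lean document; each statement's English description precedes it below -/
import Mathlib

section
/- For every l ≥ 0, the numbers of even involutions avoiding both patterns 132 and 12345 of lengths 4l+1, 4l+2, 4l+3, 4l+4 are, respectively, (3^{2l}+1)/2, 3^{2l}, (3^{2l+1}−1)/2, 3^{2l+1}. -/
open Finset

/-- The number of occurrences of the pattern `τ` (of length `k`) in the
permutation `π` (of length `n`): the number of strictly increasing index
sequences along which `π` is order-isomorphic to `τ`. -/
def occ {k n : ℕ} (τ : Equiv.Perm (Fin k)) (π : Equiv.Perm (Fin n)) : ℕ :=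
  (Finset.univ.filter (fun f : Fin k → Fin n =>
    (∀ a b : Fin k, a < b → f a < f b) ∧
    (∀ a b : Fin k, τ a < τ b ↔ π (f a) < π (f b)))).card

/-- The number of inversions of a permutation: pairs `i < j` with `π i > π j`. -/
def inversions {n : ℕ} (π : Equiv.Perm (Fin n)) : ℕ :=
  (Finset.univ.filter (fun p : Fin n × Fin n => p.1 < p.2 ∧ π p.2 < π p.1)).card

/-- The number of fixed points of a permutation. -/
def fixedPointCount {n : ℕ} (π : Equiv.Perm (Fin n)) : ℕ :=
  (Finset.univ.filter (fun j : Fin n => π j = j)).card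

/-- The pattern `132` as a permutation of `Fin 3` (zero-indexed values `0,2,1`). -/
def p132 : Equiv.Perm (Fin 3) := Equiv.swap 1 2

/-- Number of even involutions of length n avoiding both 132 and 12345. -/
def cntEven (n : ℕ) : ℕ :=
  (Finset.univ.filter (fun π : Equiv.Perm (Fin n) =>
    (∀ i, π (π i) = i) ∧ occ p132 π = 0 ∧ occ (1 : Equiv.Perm (Fin 5)) π = 0 ∧
      Even (inversions π))).card

namespace EvInv

/-- avoids 132 -/
def Av {n : ℕ} (π : Equiv.Perm (Fin n)) : Prop :=
  ∀ i j k, i < j → j < k → π i < π k → π k < π j → False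

/-- avoids 12345 -/
def NoCh {n : ℕ} (π : Equiv.Perm (Fin n)) : Prop :=
  ∀ c : Fin 5 → Fin n, (∀ a b, a < b → c a < c b ∧ π (c a) < π (c b)) → False

/-- avoiding involution whose exceedances are the first `p` positions -/
def Good {n : ℕ} (p : ℕ) (π : Equiv.Perm (Fin n)) : Prop :=
  p ≤ n ∧ (∀ i, π (π i) = i) ∧ (∀ i : Fin n, i < π i ↔ i.val < p) ∧ Av π ∧ NoCh π

/-- image of `Good` under insertion of a fixed point at `Q` -/
def Good' {n : ℕ} (Q : Fin n) (π : Equiv.Perm (Fin n)) : Prop :=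
  π Q = Q ∧ (∀ i, π (π i) = i) ∧ (∀ i : Fin n, i < π i ↔ i < Q) ∧
  (∀ i j k, i ≠ Q → j ≠ Q → k ≠ Q → i < j → j < k → π i < π k → π k < π j → False) ∧
  (∀ c : Fin 5 → Fin n, (∀ a, c a ≠ Q) →
    (∀ a b, a < b → c a < c b ∧ π (c a) < π (c b)) → False)

open Classical in
noncomputable def N (n p : ℕ) : ℕ :=
  (univ.filter (fun π : Equiv.Perm (Fin n) => Good p π)).card

lemma occ132 {n : ℕ} (π : Equiv.Perm (Fin n)) : occ p132 π = 0 ↔ Av π := by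
  unfold occ Av
  rw [Finset.card_eq_zero, Finset.filter_eq_empty_iff]
  constructor
  · intro h i j k hij hjk h1 h2
    apply h (mem_univ ![i, j, k])
    have := hij.trans hjk
    have := h1.trans h2
    constructor
    · intro a b hab
      fin_cases a <;> fin_cases b <;> simp_all
    · intro a b
      fin_cases a <;> fin_cases b <;> simp [p132, Equiv.swap_apply_def] <;> order
  · rintro h f - ⟨h1, h2⟩
    refine h (f 0) (f 1) (f 2) (h1 _ _ (by decide)) (h1 _ _ (by decide)) ?_ ?_
    · rw [← h2]; decide
    · rw [← h2]; decide

lemma occ5 {n : ℕ} (π : Equiv.Perm (Fin n)) : occ (1 : Equiv.Perm (Fin 5)) π = 0 ↔ NoCh π := by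
  unfold occ NoCh
  rw [Finset.card_eq_zero, Finset.filter_eq_empty_iff]
  constructor
  · intro h c hc
    apply h (mem_univ c)
    refine ⟨fun a b hab => (hc a b hab).1, fun a b => ?_⟩
    simp only [Equiv.Perm.coe_one, id_eq]
    refine ⟨fun hab => (hc a b hab).2, fun hab => ?_⟩
    rcases lt_trichotomy a b with h | h | h
    · exact h
    · subst h; exact absurd hab (lt_irrefl _)
    · exact absurd hab (hc b a h).2.not_gt
  · rintro h f - ⟨h1, h2⟩
    exact h f fun a b hab => ⟨h1 a b hab, (h2 a b).1 hab⟩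

/-- in a 132-avoiding involution exceedances come first -/
lemma exists_good {n : ℕ} (π : Equiv.Perm (Fin n)) (hi : ∀ i, π (π i) = i) (ha : Av π)
    (hc : NoCh π) : ∃ p, Good p π := by
  have key : ∀ i j : Fin n, i < j → j < π j → i < π i := by
    intro i j hij hj
    by_contra h
    push Not at h
    exact ha i j (π j) hij hj (by rw [hi]; order) (by rw [hi]; order)
  by_cases h : ∃ m : ℕ, ∃ hm : m < n, ¬ (⟨m, hm⟩ < π ⟨m, hm⟩)
  · classical
    have hs := Nat.find_spec h
    have hmin := fun m => @Nat.find_min _ _ h m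
    set m := Nat.find h
    obtain ⟨hm, hs⟩ := hs
    refine ⟨m, hm.le, hi, fun i => ⟨fun h1 => ?_, fun h1 => ?_⟩, ha, hc⟩
    · by_contra h2
      push Not at h2
      rcases h2.eq_or_lt with h3 | h3
      · apply hs; convert h1
      · exact hs (key ⟨m, hm⟩ i h3 h1)
    · have := hmin i.val h1
      push Not at this
      exact this i.isLt
  · push Not at h
    exact ⟨n, le_rfl, hi, fun i => ⟨fun _ => i.isLt, fun _ => h i.val i.isLt⟩, ha, hc⟩

lemma good_unique {n p q : ℕ} {π : Equiv.Perm (Fin n)} (h1 : Good p π) (h2 : Good q π) :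
    p = q := by
  have h : ∀ i : Fin n, i.val < p ↔ i.val < q := fun i => (h1.2.2.1 i).symm.trans (h2.2.2.1 i)
  have hp := h1.1
  have hq := h2.1
  rcases lt_trichotomy p q with h3 | h3 | h3
  · have := h ⟨p, by omega⟩; simp at this; omega
  · exact h3
  · have := h ⟨q, by omega⟩; simp at this; omega

lemma fixcard {n p : ℕ} {π : Equiv.Perm (Fin n)} (hp : p ≤ n) (hi : ∀ i, π (π i) = i)
    (he : ∀ i : Fin n, i < π i ↔ i.val < p) :
    (univ.filter (fun i => π i = i)).card + 2 * p = n := by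
  have h1 : (univ.filter (fun i => i < π i)).card = p := by
    simp only [he]
    rw [Fin.card_filter_val_lt]; omega
  have h2 : (univ.filter (fun i => π i < i)).card = (univ.filter (fun i => i < π i)).card := by
    refine Finset.card_bij (fun a _ => π a) ?_ ?_ ?_
    · intro a ha; simpa [hi] using ha
    · intro a _ b _ h; exact π.injective h
    · intro b hb; exact ⟨π b, by simpa [hi] using hb, hi b⟩
  have h3 : (univ : Finset (Fin n)) = univ.filter (fun i => π i = i) ∪
      (univ.filter (fun i => i < π i) ∪ univ.filter (fun i => π i < i)) := by
    ext i; simp only [mem_univ, mem_union, mem_filter, true_and, true_iff]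
    rcases lt_trichotomy i (π i) with h | h | h
    · tauto
    · left; exact h.symm
    · tauto
  have h4 := congrArg Finset.card h3
  rw [Finset.card_union_of_disjoint, Finset.card_union_of_disjoint, h2, h1] at h4
  · simp at h4; omega
  · rw [Finset.disjoint_left]; intro i; simp only [mem_filter, mem_univ, true_and]; intros; order
  · rw [Finset.disjoint_left]; intro i
    simp only [mem_filter, mem_univ, true_and, mem_union]; intro h; rw [h]; simp

lemma fix_le_four {n : ℕ} {π : Equiv.Perm (Fin n)} (h : NoCh π) :
    (univ.filter (fun i => π i = i)).card ≤ 4 := by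
  by_contra hc
  push Not at hc
  obtain ⟨t, ht, hcard⟩ := Finset.exists_subset_card_eq (show 5 ≤ _ from hc)
  refine h (t.orderEmbOfFin hcard) fun a b hab => ?_
  have hf : ∀ a, π (t.orderEmbOfFin hcard a) = t.orderEmbOfFin hcard a := fun a => by
    have := ht (t.orderEmbOfFin_mem hcard a)
    simpa using this
  rw [hf, hf]
  simpa using hab

lemma good_bounds {n p : ℕ} {π : Equiv.Perm (Fin n)} (h : Good p π) : 2 * p ≤ n ∧ n ≤ 2 * p + 4 := by
  have h1 := fixcard h.1 h.2.1 h.2.2.1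
  have h2 := fix_le_four h.2.2.2.2
  omega

lemma N_zero {n p : ℕ} (h : n < 2 * p ∨ 2 * p + 4 < n) : N n p = 0 := by
  classical
  unfold N
  rw [Finset.card_eq_zero, Finset.filter_eq_empty_iff]
  intro π _ hg
  have := good_bounds hg
  omega

lemma N00 : N 0 0 = 1 := by
  unfold N
  rw [Finset.card_eq_one]
  refine ⟨1, ?_⟩
  ext π
  simp only [mem_filter, mem_univ, true_and, mem_singleton]
  refine ⟨fun _ => Subsingleton.elim _ _, fun _ => ?_⟩
  exact ⟨le_rfl, fun i => i.elim0, fun i => i.elim0, fun i => i.elim0, fun c => (c 0).elim0⟩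

lemma sign_inversions {n : ℕ} (π : Equiv.Perm (Fin n)) :
    ((Equiv.Perm.sign π : ℤˣ)) = (-1) ^ inversions π := by
  rw [Equiv.Perm.sign_eq_prod_prod_Ioi]
  unfold inversions
  rw [← Finset.prod_const, Finset.prod_filter, ← Finset.univ_product_univ, Finset.prod_product]
  refine Finset.prod_congr rfl fun i _ => ?_
  rw [← Finset.filter_lt_eq_Ioi, Finset.prod_filter]
  refine Finset.prod_congr rfl fun j _ => ?_
  by_cases h : i < j
  · have := π.injective.ne h.ne
    rcases lt_or_gt_of_ne this with h1 | h1
    · simp [h, h1, h1.not_gt]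
    · simp [h, h1, h1.not_gt]
  · simp [h]

lemma sign_invol {n p : ℕ} {π : Equiv.Perm (Fin n)} (h : Good p π) :
    ((Equiv.Perm.sign π : ℤˣ)) = (-1) ^ p := by
  have h1 := fixcard h.1 h.2.1 h.2.2.1
  have h2 : ∀ x ∈ π.cycleType, x = 2 := by
    intro x hx
    have ha := Equiv.Perm.two_le_of_mem_cycleType hx
    have hb := Equiv.Perm.dvd_of_mem_cycleType hx
    have hc : orderOf π ∣ 2 := orderOf_dvd_of_pow_eq_one (by
      ext i; simp [pow_two, h.2.1])
    have := Nat.le_of_dvd (by norm_num) (hb.trans hc)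
    omega
  have h3 := Multiset.eq_replicate_card.2 h2
  have h4 := π.sum_cycleType
  have h5 : π.support.card + (univ.filter (fun i => π i = i)).card = n := by
    have := Finset.card_filter_add_card_filter_not (s := (univ : Finset (Fin n))) (fun i => π i = i)
    rw [Finset.card_univ, Fintype.card_fin] at this
    have h6 : π.support = univ.filter (fun i => ¬ π i = i) := by
      ext i; simp
    rw [h6]; omega
  rw [h3, Multiset.sum_replicate, smul_eq_mul] at h4
  have h6 : π.cycleType.card = p := by omega
  rw [Equiv.Perm.sign_of_cycleType, π.sum_cycleType, h6, pow_add]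
  have : π.support.card = 2 * p := by omega
  rw [this, pow_mul]; simp

lemma even_iff {n p : ℕ} {π : Equiv.Perm (Fin n)} (h : Good p π) :
    Even (inversions π) ↔ Even p := by
  have h1 := sign_inversions π
  rw [sign_invol h] at h1
  rcases Nat.even_or_odd p with hp | hp <;> rcases Nat.even_or_odd (inversions π) with hq | hq
  · tauto
  · rw [hp.neg_one_pow, hq.neg_one_pow] at h1; exact absurd h1 (by decide)
  · rw [hp.neg_one_pow, hq.neg_one_pow] at h1; exact absurd h1 (by decide)
  · simp [Nat.not_even_iff_odd.2 hp, Nat.not_even_iff_odd.2 hq]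

open Classical in
lemma cntEven_eq (n : ℕ) : cntEven n =
    (univ.filter (fun π : Equiv.Perm (Fin n) => ∃ p, Good p π ∧ Even p)).card := by
  unfold cntEven
  congr 1
  ext π
  simp only [mem_filter, mem_univ, true_and, occ132, occ5]
  constructor
  · rintro ⟨h1, h2, h3, h4⟩
    obtain ⟨p, hp⟩ := exists_good π h1 h2 h3
    exact ⟨p, hp, (even_iff hp).1 h4⟩
  · rintro ⟨p, hp, h4⟩
    exact ⟨hp.2.1, hp.2.2.2.1, hp.2.2.2.2, (even_iff hp).2 h4⟩

lemma cntEven_single (n p : ℕ) (hp : Even p)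
    (h : ∀ q, Even q → 2 * q ≤ n → n ≤ 2 * q + 4 → q = p) : cntEven n = N n p := by
  rw [cntEven_eq, N]
  congr 1
  ext π
  simp only [mem_filter, mem_univ, true_and]
  constructor
  · rintro ⟨q, hq, h4⟩
    have := good_bounds hq
    rwa [← h q h4 this.1 this.2]
  · exact fun hq => ⟨p, hq, hp⟩

lemma cntEven_double (n p p' : ℕ) (hp : Even p) (hp' : Even p') (hne : p ≠ p')
    (h : ∀ q, Even q → 2 * q ≤ n → n ≤ 2 * q + 4 → q = p ∨ q = p') :
    cntEven n = N n p + N n p' := by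
  classical
  rw [cntEven_eq, N, N, ← Finset.card_union_of_disjoint]
  · congr 1
    ext π
    simp only [mem_filter, mem_univ, true_and, mem_union]
    constructor
    · rintro ⟨q, hq, h4⟩
      have := good_bounds hq
      rcases h q h4 this.1 this.2 with h5 | h5
      · left; rwa [← h5]
      · right; rwa [← h5]
    · rintro (hq | hq)
      exacts [⟨p, hq, hp⟩, ⟨p', hq, hp'⟩]
  · rw [Finset.disjoint_left]
    intro π h1 h2
    simp only [mem_filter, mem_univ, true_and] at h1 h2
    exact hne (good_unique h1 h2)

/-- insertion of a fixed point -/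
def ins {n : ℕ} (Q : Fin (n + 1)) (π : Equiv.Perm (Fin n)) : Equiv.Perm (Fin (n + 1)) :=
  (finSuccEquiv' Q).trans ((Equiv.optionCongr π).trans (finSuccEquiv' Q).symm)

lemma ins_self {n : ℕ} (Q : Fin (n + 1)) (π : Equiv.Perm (Fin n)) : ins Q π Q = Q := by
  simp [ins]

lemma ins_succAbove {n : ℕ} (Q : Fin (n + 1)) (π : Equiv.Perm (Fin n)) (i : Fin n) :
    ins Q π (Q.succAbove i) = Q.succAbove (π i) := by
  simp [ins]

lemma ins_surj {n : ℕ} (Q : Fin (n + 1)) (α : Equiv.Perm (Fin (n + 1))) (h : α Q = Q) :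
    ∃ π, ins Q π = α := by
  have hx : ∀ i : Fin n, ∃ j, Q.succAbove j = α (Q.succAbove i) := fun i => by
    apply Fin.exists_succAbove_eq
    intro hc
    exact Fin.succAbove_ne Q i (α.injective (hc.trans h.symm))
  choose f hf using hx
  have hinj : Function.Injective f := by
    intro a b hab
    have := hf a
    rw [hab, hf b] at this
    exact (Fin.succAbove_right_injective (α.injective this)).symm
  refine ⟨Equiv.ofBijective f (Finite.injective_iff_bijective.1 hinj), ?_⟩
  ext x
  rcases eq_or_ne x Q with rfl | hne
  · rw [ins_self, h]
  · obtain ⟨y, rfl⟩ := Fin.exists_succAbove_eq hne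
    rw [ins_succAbove, ← hf]; rfl

lemma good'_ins {n : ℕ} (Q : Fin (n + 1)) (π : Equiv.Perm (Fin n)) :
    Good' Q (ins Q π) ↔ Good Q.val π := by
  have hQ : ∀ i : Fin n, Q.succAbove i < Q ↔ i.val < Q.val := fun i => by
    rw [Fin.succAbove_lt_iff_castSucc_lt]; rfl
  constructor
  · rintro ⟨h1, h2, h3, h4, h5⟩
    refine ⟨by omega, fun i => ?_, fun i => ?_, fun i j k => ?_, fun c hc => ?_⟩
    · have := h2 (Q.succAbove i)
      rw [ins_succAbove, ins_succAbove] at this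
      exact Fin.succAbove_right_injective this
    · have := h3 (Q.succAbove i)
      rw [ins_succAbove, hQ] at this
      simpa using this
    · have := h4 (Q.succAbove i) (Q.succAbove j) (Q.succAbove k) (Fin.succAbove_ne _ _)
        (Fin.succAbove_ne _ _) (Fin.succAbove_ne _ _)
      simpa [ins_succAbove] using this
    · refine h5 (fun a => Q.succAbove (c a)) (fun a => Fin.succAbove_ne _ _) fun a b hab => ?_
      simpa [ins_succAbove] using hc a b hab
  · rintro ⟨h1, h2, h3, h4, h5⟩
    refine ⟨ins_self _ _, fun i => ?_, fun i => ?_, fun i j k hi hj hk => ?_, fun c hQ hc => ?_⟩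
    · rcases eq_or_ne i Q with rfl | hne
      · simp [ins_self]
      · obtain ⟨y, rfl⟩ := Fin.exists_succAbove_eq hne
        simp [ins_succAbove, h2]
    · rcases eq_or_ne i Q with rfl | hne
      · simp [ins_self]
      · obtain ⟨y, rfl⟩ := Fin.exists_succAbove_eq hne
        rw [ins_succAbove, hQ, ← h3]
        simp
    · obtain ⟨i, rfl⟩ := Fin.exists_succAbove_eq hi
      obtain ⟨j, rfl⟩ := Fin.exists_succAbove_eq hj
      obtain ⟨k, rfl⟩ := Fin.exists_succAbove_eq hk
      simpa [ins_succAbove] using h4 i j k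
    · have := fun a => Fin.exists_succAbove_eq (hQ a)
      choose d hd using this
      refine h5 d fun a b hab => ?_
      have := hc a b hab
      rw [← hd, ← hd] at this
      simpa [ins_succAbove] using this

open Classical in
lemma card_good' {n : ℕ} (Q : Fin (n + 1)) :
    (univ.filter (fun α : Equiv.Perm (Fin (n + 1)) => Good' Q α)).card = N n Q.val := by
  symm
  refine Finset.card_bij (fun π _ => ins Q π) ?_ ?_ ?_
  · intro π h
    simpa [good'_ins] using h
  · intro π _ π' _ h
    ext i
    have := congrArg (fun e => e (Q.succAbove i)) h
    simp only [ins_succAbove] at this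
    rw [Fin.succAbove_right_injective this]
  · intro α h
    simp only [mem_filter, mem_univ, true_and] at h
    obtain ⟨π, rfl⟩ := ins_surj Q α h.1
    exact ⟨π, by simpa [good'_ins] using h, rfl⟩

/-- if both indices are non-exceedances with value beyond, then fixed -/
lemma good'_fixed {n : ℕ} {Q : Fin n} {α : Equiv.Perm (Fin n)} (h2 : ∀ i, α (α i) = i)
    (h3 : ∀ i : Fin n, i < α i ↔ i < Q) {x : Fin n} (hx : Q ≤ x) (hy : Q ≤ α x) : α x = x := by
  have a := h3 x
  have b := h3 (α x)
  rw [h2] at b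
  rw [← not_lt] at hx hy
  have := fun h => hx (a.1 h)
  have := fun h => hy (b.1 h)
  order

/-- the fixed part of the recurrence -/
lemma good'_iff {n p : ℕ} {Q : Fin n} (hQ : Q.val = p) (hn : n ≤ 2 * p + 4)
    {α : Equiv.Perm (Fin n)} : Good' Q α ↔ Good p α ∧ α Q = Q := by
  constructor
  · rintro ⟨h1, h2, h3, h4, h5⟩
    have hlow : ∀ i, i < Q → α i < Q → False := by
      intro i hi hj
      have a := (h3 i).2 hi
      have b := (h3 (α i)).2 hj
      rw [h2] at b; order
    have h3' : ∀ i : Fin n, i < α i ↔ i.val < p := fun i => by rw [h3, Fin.lt_def, hQ]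
    refine ⟨⟨by omega, h2, h3', ?_, ?_⟩, h1⟩
    · intro i j k hij hjk h6 h7
      by_cases hiQ : i = Q
      · subst hiQ
        rw [h1] at h6
        have ej := good'_fixed h2 h3 hij.le (by order)
        have ek := good'_fixed h2 h3 (x := k) (by order) (by order)
        order
      by_cases hjQ : j = Q
      · subst hjQ
        exact hlow i hij (by order)
      by_cases hkQ : k = Q
      · subst hkQ
        exact hlow i (by order) (by order)
      exact h4 i j k hiQ hjQ hkQ hij hjk h6 h7
    · intro c hc
      by_cases hex : ∀ a, c a ≠ Q
      · exact h5 c hex hc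
      push Not at hex
      obtain ⟨a, ha⟩ := hex
      have ha0 : ∀ b, a ≤ b := by
        intro b
        by_contra hb
        push Not at hb
        have := hc b a hb
        rw [ha, h1] at this
        exact hlow _ this.1 this.2
      have hfix : ∀ b, α (c b) = c b := by
        intro b
        rcases (ha0 b).eq_or_lt with rfl | hb
        · rw [ha, h1]
        · have := hc a b hb
          rw [ha, h1] at this
          exact good'_fixed h2 h3 this.1.le this.2.le
      have hcard := fixcard (by omega) h2 h3'
      have hinj : Function.Injective c := by
        intro x y hxy
        rcases lt_trichotomy x y with h | h | h
        · exact absurd hxy (hc _ _ h).1.ne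
        · exact h
        · exact absurd hxy (hc _ _ h).1.ne'
      have : (univ.image c).card = 5 := by
        rw [Finset.card_image_of_injective _ hinj]; simp
      have hle := Finset.card_le_card (show univ.image c ⊆ univ.filter (fun i => α i = i) by
        intro x hx
        simp only [mem_image, mem_univ, true_and] at hx
        obtain ⟨b, rfl⟩ := hx
        simp [hfix])
      omega
  · rintro ⟨⟨_, h2, h3, h4, h5⟩, h1⟩
    exact ⟨h1, h2, fun i => by rw [h3, Fin.lt_def, hQ], fun i j k _ _ _ => h4 i j k,
      fun c _ => h5 c⟩

/-- `π` arises from `α` by joining the fixed points `Q < F` into a 2-cycle -/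
structure Rel {n : ℕ} (Q F : Fin n) (α π : Equiv.Perm (Fin n)) : Prop where
  lt : Q < F
  aQ : α Q = Q
  aF : α F = F
  pQ : π Q = F
  pF : π F = Q
  eq : ∀ x, x ≠ Q → x ≠ F → π x = α x
  ia : ∀ x, α (α x) = x
  ip : ∀ x, π (π x) = x
  ea : ∀ x, x < α x ↔ x < Q
  ep : ∀ x, x < π x ↔ x ≤ Q
  first : ∀ x, α x = x → x ≠ Q → F ≤ x

namespace Rel
variable {n : ℕ} {Q F : Fin n} {α π : Equiv.Perm (Fin n)}

lemma lowp (h : Rel Q F α π) {x : Fin n} (hx : x ≤ Q) : Q < π x := by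
  have a := (h.ep x).2 hx
  have b := h.ep (π x)
  rw [h.ip] at b
  by_contra hc
  push Not at hc
  have := b.2 hc
  order

/-- values above `Q` at positions after `Q` are fixed points beyond `F` -/
lemma upp (h : Rel Q F α π) {x : Fin n} (hx : Q < x) (hy : Q < π x) : π x = x ∧ F < x := by
  have a := h.ep x
  have b := h.ep (π x)
  rw [h.ip] at b
  rw [← not_le] at hx hy
  have h1 := fun h => hx (a.1 h)
  have h2 := fun h => hy (b.1 h)
  have h3 : π x = x := by order
  have h4 : x ≠ Q := by intro h; apply hx; order
  have h5 : x ≠ F := by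
    intro h5; subst h5; rw [h.pF] at h3; exact h.lt.ne h3
  refine ⟨h3, lt_of_le_of_ne (h.first x ?_ h4) h5.symm⟩
  rw [← h.eq x h4 h5, h3]

lemma lowa (h : Rel Q F α π) {x : Fin n} (hx : x < Q) : Q < α x := by
  rw [← h.eq x hx.ne (hx.trans h.lt).ne]
  exact h.lowp hx.le

lemma upa (h : Rel Q F α π) {x : Fin n} (hx : Q < x) (hy : Q < α x) : α x = x ∧ F ≤ x := by
  by_cases hF : x = F
  · subst hF; exact ⟨h.aF, le_rfl⟩
  · have := h.upp hx (by rwa [h.eq x hx.ne' hF])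
    rw [h.eq x hx.ne' hF] at this
    exact ⟨this.1, this.2.le⟩

/-- avoidance is kept, auxiliary: first of the two symmetric cases -/
lemma av_auxQ (h : Rel Q F α π)
    (hA : ∀ i j k, i ≠ Q → j ≠ Q → k ≠ Q → i < j → j < k → α i < α k → α k < α j → False)
    (i j k : Fin n) (hij : i < j) (hjk : j < k) (h1 : π i < π k) (h2 : π k < π j)
    (hQ : i = Q ∨ j = Q ∨ k = Q) : False := by
  have hlt := h.lt
  have pQ := h.pQ
  rcases hQ with hQ | hQ | hQ
  · subst hQ
    have a := h.upp hij (by order)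
    have b := h.upp (x := k) (by order) (by order)
    order
  · subst hQ
    have a := h.lowp hij.le
    have b := h.upp hjk (by order)
    order
  · subst hQ
    have hi := h.eq i (by order) (by order)
    have hj := h.eq j (by order) (by order)
    exact hA i j F (by order) (by order) (by order) hij (by order)
      (by rw [h.aF]; order) (by rw [h.aF]; order)

lemma av_fwd (h : Rel Q F α π)
    (hA : ∀ i j k, i ≠ Q → j ≠ Q → k ≠ Q → i < j → j < k → α i < α k → α k < α j → False) :
    Av π := by
  intro i j k hij hjk h1 h2
  by_cases hQ : i = Q ∨ j = Q ∨ k = Q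
  · exact h.av_auxQ hA i j k hij hjk h1 h2 hQ
  by_cases hF : i = F ∨ j = F ∨ k = F
  · refine h.av_auxQ hA (π i) (π k) (π j) h1 h2 (by rwa [h.ip, h.ip]) (by rwa [h.ip, h.ip]) ?_
    rcases hF with rfl | rfl | rfl
    · left; exact h.pF
    · right; right; exact h.pF
    · right; left; exact h.pF
  push Not at hQ hF
  refine hA i j k hQ.1 hQ.2.1 hQ.2.2 hij hjk ?_ ?_
  · rwa [← h.eq i hQ.1 hF.1, ← h.eq k hQ.2.2 hF.2.2]
  · rwa [← h.eq j hQ.2.1 hF.2.1, ← h.eq k hQ.2.2 hF.2.2]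

/-- auxiliary: `F` in role 3 or 2, with role 1 played by an exceedance -/
lemma av_auxF (h : Rel Q F α π) (hA : Av π)
    (i j k : Fin n) (hiQ : i < Q) (hjQ : j ≠ Q) (hkQ : k ≠ Q)
    (hij : i < j) (hjk : j < k) (h1 : α i < α k) (h2 : α k < α j)
    (hF : j = F ∨ k = F) : False := by
  have hlt := h.lt
  have pQ := h.pQ
  have aF := h.aF
  have ei := h.eq i hiQ.ne (by order)
  rcases hF with hF | hF
  · subst hF
    have ek := h.eq k hkQ (by order)
    exact hA i Q k hiQ (by order) (by order) (by order)
  · subst hF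
    rcases lt_or_gt_of_ne hjQ with hj | hj
    · have ej := h.eq j hjQ (by order)
      exact hA i j Q hij hj (by order) (by order)
    · have := h.upa hj (by order)
      order

lemma av_bwd (h : Rel Q F α π) (hA : Av π) (i j k : Fin n) (hiQ : i ≠ Q) (hjQ : j ≠ Q)
    (hkQ : k ≠ Q) (hij : i < j) (hjk : j < k) (h1 : α i < α k) (h2 : α k < α j) : False := by
  have hlt := h.lt
  have aF := h.aF
  by_cases hi : i = F
  · subst hi
    have a := h.upa (x := j) (by order) (by order)
    have b := h.upa (x := k) (by order) (by order)
    order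
  by_cases hF : j = F ∨ k = F
  · rcases lt_or_gt_of_ne hiQ with hi' | hi'
    · exact h.av_auxF hA i j k hi' hjQ hkQ hij hjk h1 h2 hF
    · have hne : ∀ x, x ≠ Q → α x ≠ Q := by
        intro x hx hc
        apply hx
        rw [← h.ia x, hc, h.aQ]
      have hai : α i < Q := by
        by_contra hc
        push Not at hc
        have := h.upa hi' (lt_of_le_of_ne hc (hne i hiQ).symm)
        rcases hF with rfl | rfl <;> order
      refine h.av_auxF hA (α i) (α k) (α j) hai (hne _ hkQ) (hne _ hjQ) h1 h2
        (by rwa [h.ia, h.ia]) (by rwa [h.ia, h.ia]) ?_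
      rcases hF with rfl | rfl
      · right; exact aF
      · left; exact aF
  push Not at hF
  refine hA i j k hij hjk ?_ ?_
  · rwa [h.eq i hiQ hi, h.eq k hkQ hF.2]
  · rwa [h.eq j hjQ hF.1, h.eq k hkQ hF.2]

lemma ch_fwd (h : Rel Q F α π)
    (hC : ∀ c : Fin 5 → Fin n, (∀ a, c a ≠ Q) →
      (∀ a b, a < b → c a < c b ∧ α (c a) < α (c b)) → False) : NoCh π := by
  intro c hc
  have hlt := h.lt
  have aF := h.aF
  have pF := h.pF
  have pQ := h.pQ
  refine hC (fun a => if c a = Q then F else c a) ?_ ?_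
  · intro a
    split_ifs with h1
    · exact hlt.ne'
    · exact h1
  · intro a b hab
    obtain ⟨h1, h2⟩ := hc a b hab
    generalize c a = x at *
    generalize c b = y at *
    by_cases hx : x = Q
    · subst hx
      have := h.upp h1 (by order)
      have ey := h.eq y h1.ne' (by order)
      rw [if_pos rfl, if_neg h1.ne']
      constructor <;> order
    · rw [if_neg hx]
      by_cases hy : y = Q
      · subst hy
        have ex := h.eq x hx (by order)
        rw [if_pos rfl]
        constructor <;> order
      · rw [if_neg hy]
        refine ⟨h1, ?_⟩
        by_cases hxF : x = F
        · subst hxF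
          have := h.upp (x := y) (by order) (by order)
          have ey := h.eq y hy (by order)
          order
        · have ex := h.eq x hx hxF
          by_cases hyF : y = F
          · subst hyF; order
          · have ey := h.eq y hy hyF
            order

lemma ch_bwd (h : Rel Q F α π) (hC : NoCh π) (c : Fin 5 → Fin n) (hQ : ∀ a, c a ≠ Q)
    (hc : ∀ a b, a < b → c a < c b ∧ α (c a) < α (c b)) : False := by
  have hlt := h.lt
  have aF := h.aF
  have pF := h.pF
  have pQ := h.pQ
  by_cases hex : ∃ a, c a < F ∧ Q < c a
  · obtain ⟨a0, ha0, ha1⟩ := hex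
    have hlow : ∀ x, Q < x → x < F → α x < Q := by
      intro x hx1 hx2
      by_contra hcon
      push Not at hcon
      rcases hcon.eq_or_lt with h3 | h3
      · have := h.ia x
        rw [← h3, h.aQ] at this
        order
      · have := h.upa hx1 h3
        order
    have hl0 := hlow _ ha1 ha0
    refine hC c fun a b hab => ⟨(hc a b hab).1, ?_⟩
    obtain ⟨h1, h2⟩ := hc a b hab
    have hQa := hQ a
    have hQb := hQ b
    by_cases hxF : c a = F
    · have ey := h.eq (c b) hQb (by order)
      rw [hxF] at h2 ⊢
      order
    · have ex := h.eq (c a) hQa hxF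
      by_cases hyF : c b = F
      · rw [hyF] at h1 ⊢
        rw [pF, ex]
        apply hlow _ _ h1
        by_contra hcon
        have hlt' : c a < Q := by order
        have h5 := h.lowa hlt'
        rcases lt_trichotomy a a0 with h6 | h6 | h6
        · have := (hc _ _ h6).2; order
        · subst h6; order
        · have := (hc _ _ h6).1; order
      · have ey := h.eq (c b) hQb hyF
        order
  · push Not at hex
    refine hC (fun a => if c a = F then Q else c a) ?_
    intro a b hab
    obtain ⟨h1, h2⟩ := hc a b hab
    have hxa := hex a
    have hQa := hQ a
    have hQb := hQ b
    generalize c a = x at *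
    generalize c b = y at *
    by_cases hx : x = F
    · subst hx
      have ey := h.eq y hQb (by order)
      rw [if_pos rfl, if_neg (by order)]
      constructor <;> order
    · rw [if_neg hx]
      have ex := h.eq x hQa hx
      by_cases hy : y = F
      · subst hy
        have := hxa h1
        rw [if_pos rfl]
        constructor <;> order
      · have ey := h.eq y hQb hy
        rw [if_neg hy]
        constructor <;> order

end Rel

lemma rel_of_good' {n p : ℕ} {Q F P : Fin n} (hQ : Q.val = p) (hP : P.val = p + 1)
    {α : Equiv.Perm (Fin n)} (hα : Good' Q α) (aF : α F = F) (hne : F ≠ Q)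
    (hfirst : ∀ x, α x = x → x ≠ Q → F ≤ x) :
    Rel Q F α (Equiv.swap Q F * α) ∧ Good (p + 1) (Equiv.swap Q F * α) ∧
      (Equiv.swap Q F * α) P ≠ P := by
  obtain ⟨h1, h2, h3, h4, h5⟩ := hα
  have hlt : Q < F := by
    rcases lt_or_gt_of_ne hne with h | h
    · have := (h3 F).2 h
      rw [aF] at this; exact absurd this (lt_irrefl _)
    · exact h
  have hneQ : ∀ x, x ≠ Q → α x ≠ Q := by
    intro x hx hc
    apply hx; rw [← h2 x, hc, h1]
  have hneF : ∀ x, x ≠ F → α x ≠ F := by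
    intro x hx hc
    apply hx; rw [← h2 x, hc, aF]
  have pQ : (Equiv.swap Q F * α) Q = F := by simp [h1]
  have pF : (Equiv.swap Q F * α) F = Q := by simp [aF]
  have peq : ∀ x, x ≠ Q → x ≠ F → (Equiv.swap Q F * α) x = α x := by
    intro x hx hF
    rw [Equiv.Perm.mul_apply, Equiv.swap_apply_of_ne_of_ne (hneQ x hx) (hneF x hF)]
  have ip : ∀ x, (Equiv.swap Q F * α) ((Equiv.swap Q F * α) x) = x := by
    intro x
    by_cases hx : x = Q
    · rw [hx, pQ, pF]
    by_cases hF : x = F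
    · rw [hF, pF, pQ]
    rw [peq x hx hF, peq _ (hneQ x hx) (hneF x hF), h2]
  have ep : ∀ x, x < (Equiv.swap Q F * α) x ↔ x ≤ Q := by
    intro x
    by_cases hx : x = Q
    · subst hx; rw [pQ]; simp [hlt]
    by_cases hF : x = F
    · rw [hF, pF]; exact ⟨le_of_lt, fun h => absurd hlt h.not_gt⟩
    rw [peq x hx hF, h3]
    exact ⟨le_of_lt, fun h => lt_of_le_of_ne h hx⟩
  have hR : Rel Q F α (Equiv.swap Q F * α) :=
    ⟨hlt, h1, aF, pQ, pF, peq, h2, ip, h3, ep, hfirst⟩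
  refine ⟨hR, ⟨by omega, ip, fun i => ?_, hR.av_fwd h4, hR.ch_fwd h5⟩, fun hPP => ?_⟩
  · rw [ep, Fin.le_def, hQ]; omega
  · have hPQ : Q < P := by rw [Fin.lt_def]; omega
    have := (hR.upp hPQ (by rw [hPP]; exact hPQ)).2
    rw [Fin.lt_def] at this hlt
    omega

lemma good'_of_good {n p : ℕ} {Q P : Fin n} (hQ : Q.val = p) (hP : P.val = p + 1)
    {π : Equiv.Perm (Fin n)} (hπ : Good (p + 1) π) (hPP : π P ≠ P) :
    Good' Q (Equiv.swap Q (π Q) * π) ∧ (Equiv.swap Q (π Q) * π) (π Q) = π Q ∧ π Q ≠ Q ∧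
    (∀ x, (Equiv.swap Q (π Q) * π) x = x → x ≠ Q → π Q ≤ x) := by
  obtain ⟨-, ip, h3, h4, h5⟩ := hπ
  have ep : ∀ x, x < π x ↔ x ≤ Q := by
    intro x; rw [h3, Fin.le_def]; omega
  have hlt : Q < π Q := (ep Q).2 le_rfl
  obtain ⟨F, hF⟩ : ∃ F, F = π Q := ⟨_, rfl⟩
  rw [← hF] at hlt ⊢
  have pF : π F = Q := by rw [hF, ip]
  have aQ : (Equiv.swap Q F * π) Q = Q := by simp [← hF]
  have aF : (Equiv.swap Q F * π) F = F := by simp [pF]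
  have hneQ : ∀ x, x ≠ F → π x ≠ Q := by
    intro x hx hc
    apply hx; rw [← ip x, hc, hF]
  have hneF : ∀ x, x ≠ Q → π x ≠ F := by
    intro x hx hc
    apply hx; rw [← ip x, hc, pF]
  have aeq : ∀ x, x ≠ Q → x ≠ F → (Equiv.swap Q F * π) x = π x := by
    intro x hx hx'
    rw [Equiv.Perm.mul_apply, Equiv.swap_apply_of_ne_of_ne (hneQ x hx') (hneF x hx)]
  have ia : ∀ x, (Equiv.swap Q F * π) ((Equiv.swap Q F * π) x) = x := by
    intro x
    by_cases hx : x = Q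
    · rw [hx, aQ, aQ]
    by_cases hx' : x = F
    · rw [hx', aF, aF]
    rw [aeq x hx hx', aeq _ (hneQ x hx') (hneF x hx), ip]
  have ea : ∀ x, x < (Equiv.swap Q F * π) x ↔ x < Q := by
    intro x
    by_cases hx : x = Q
    · subst hx; rw [aQ]
    by_cases hx' : x = F
    · subst hx'; rw [aF]; simp [hlt.le]
    rw [aeq x hx hx', ep]
    exact ⟨fun h => lt_of_le_of_ne h hx, le_of_lt⟩
  have hfirst : ∀ x, (Equiv.swap Q F * π) x = x → x ≠ Q → F ≤ x := by
    intro x hx hxQ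
    by_contra hcon
    push Not at hcon
    rw [aeq x hxQ hcon.ne] at hx
    have hPQ : Q < P := by rw [Fin.lt_def]; omega
    have hxQ' : Q < x := by
      by_contra hc
      have := (ep x).2 (by order)
      order
    have hPx : P < x := by
      have : P ≠ x := by rintro rfl; exact hPP hx
      have h6 : P ≤ x := by rw [Fin.le_def]; rw [Fin.lt_def] at hxQ'; omega
      order
    have hPl : π P < P := by
      have := (ep P).not.2 (by order)
      order
    have hPl' : π P ≤ Q := by
      rw [← ep, ip]; exact hPl
    have hPl2 : π P ≠ Q := hneQ P (by order)
    exact h4 (π P) Q x (by order) hxQ' (by rw [ip]; order) (by order)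
  have hR : Rel Q F (Equiv.swap Q F * π) π :=
    ⟨hlt, aQ, aF, hF.symm, pF, fun x a b => (aeq x a b).symm, ia, ip, ea, ep, hfirst⟩
  exact ⟨⟨aQ, ia, ea, hR.av_bwd h4, hR.ch_bwd h5⟩, aF, hlt.ne', hfirst⟩

open Classical in
lemma card_swap {n p : ℕ} (hn : 2 * (p + 1) ≤ n) {Q P : Fin n} (hQ : Q.val = p)
    (hP : P.val = p + 1) :
    (univ.filter (fun α : Equiv.Perm (Fin n) => Good' Q α)).card =
    (univ.filter (fun π : Equiv.Perm (Fin n) => Good (p + 1) π ∧ π P ≠ P)).card := by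
  have hex : ∀ α : Equiv.Perm (Fin n), ∃ F, Good' Q α →
      (α F = F ∧ F ≠ Q ∧ ∀ x, α x = x → x ≠ Q → F ≤ x) := by
    intro α
    by_cases hα : Good' Q α
    swap
    · exact ⟨Q, fun h => absurd h hα⟩
    have hc := fixcard (n := n) (p := p) (by omega) hα.2.1
      (fun i => by rw [hα.2.2.1, Fin.lt_def, hQ])
    have hne : ((univ.filter (fun i => α i = i)).erase Q).Nonempty := by
      rw [← Finset.card_pos, Finset.card_erase_of_mem (by simp [hα.1])]
      omega
    refine ⟨((univ.filter (fun i => α i = i)).erase Q).min' hne, fun _ => ?_⟩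
    have hm := Finset.min'_mem _ hne
    simp only [mem_erase, mem_filter, mem_univ, true_and] at hm
    refine ⟨hm.2, hm.1, fun x hx hxQ => Finset.min'_le _ _ (by simp [hx, hxQ])⟩
  choose F hF using hex
  refine Finset.card_bij (fun α _ => Equiv.swap Q (F α) * α) ?_ ?_ ?_
  · intro α h
    simp only [mem_filter, mem_univ, true_and] at h ⊢
    obtain ⟨a, b, c⟩ := hF α h
    exact (rel_of_good' hQ hP h a b c).2
  · intro α h β h' heq
    simp only [mem_filter, mem_univ, true_and] at h h'
    have e := congrArg (fun e => e Q) heq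
    simp only [Equiv.Perm.mul_apply, h.1, h'.1, Equiv.swap_apply_left] at e
    simp only [e] at heq
    exact mul_left_cancel heq
  · intro π h
    simp only [mem_filter, mem_univ, true_and] at h
    obtain ⟨a, b, c, d⟩ := good'_of_good hQ hP h.1 h.2
    refine ⟨Equiv.swap Q (π Q) * π, by simpa using a, ?_⟩
    obtain ⟨b', c', d'⟩ := hF _ a
    have : F (Equiv.swap Q (π Q) * π) = π Q := le_antisymm (d' _ b c) (d _ b' c')
    rw [this, ← mul_assoc, Equiv.swap_mul_self, one_mul]

lemma rec0 {n : ℕ} (hn : n + 1 ≤ 4) : N (n + 1) 0 = N n 0 := by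
  classical
  have := card_good' (n := n) 0
  rw [Fin.val_zero] at this
  rw [← this, N]
  congr 1
  ext π
  simp only [mem_filter, mem_univ, true_and]
  rw [good'_iff (p := 0) rfl (by omega)]
  refine ⟨fun h => ⟨h, ?_⟩, fun h => h.1⟩
  have h1 : ¬ (0 < π 0) := by rw [h.2.2.1]; simp
  exact Fin.le_zero_iff.1 (not_lt.1 h1)

lemma rec1 {n p : ℕ} (h1 : 2 * (p + 1) ≤ n + 1) (h2 : n + 1 ≤ 2 * (p + 1) + 4) :
    N (n + 1) (p + 1) = N n (p + 1) + N n p := by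
  classical
  have hP := card_good' (n := n) ⟨p + 1, by omega⟩
  have hQ := card_good' (n := n) ⟨p, by omega⟩
  rw [card_swap (p := p) h1 (P := ⟨p + 1, by omega⟩) rfl rfl] at hQ
  dsimp only at hP hQ
  rw [← hP, ← hQ, N, ← Finset.card_filter_add_card_filter_not
    (fun π : Equiv.Perm (Fin (n + 1)) => π ⟨p + 1, by omega⟩ = ⟨p + 1, by omega⟩),
    Finset.filter_filter, Finset.filter_filter]
  congr 2
  ext π
  simp only [mem_filter, mem_univ, true_and]
  rw [good'_iff (p := p + 1) rfl (by omega)]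

lemma base4 : N 1 0 = 1 ∧ N 2 0 = 1 ∧ N 3 0 = 1 ∧ N 4 0 = 1 ∧ N 4 1 = 3 ∧ N 4 2 = 2 := by
  have a1 : N 1 0 = 1 := by rw [rec0 (by norm_num), N00]
  have a2 : N 2 0 = 1 := by rw [rec0 (by norm_num), a1]
  have a3 : N 3 0 = 1 := by rw [rec0 (by norm_num), a2]
  have a4 : N 4 0 = 1 := by rw [rec0 (by norm_num), a3]
  have b1 : N 1 1 = 0 := N_zero (by norm_num)
  have b2 : N 2 1 = 1 := by rw [rec1 (by norm_num) (by norm_num), a1, b1]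
  have b3 : N 3 1 = 2 := by rw [rec1 (by norm_num) (by norm_num), a2, b2]
  have b4 : N 4 1 = 3 := by rw [rec1 (by norm_num) (by norm_num), a3, b3]
  have c3 : N 3 2 = 0 := N_zero (by norm_num)
  have c4 : N 4 2 = 2 := by rw [rec1 (by norm_num) (by norm_num), b3, c3]
  exact ⟨a1, a2, a3, a4, b4, c4⟩

/-- values of `N` on four consecutive rows, from the row above -/
lemma step (l x : ℕ) (h0 : 2 * N (4 * l + 4) (2 * l) + 1 = x) (h1 : N (4 * l + 4) (2 * l + 1) = x)
    (h2 : 2 * N (4 * l + 4) (2 * l + 2) = x + 1) :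
    2 * N (4 * l + 5) (2 * l + 2) = 3 * x + 1 ∧
    N (4 * l + 6) (2 * l + 2) = 3 * x ∧
    2 * N (4 * l + 7) (2 * l + 2) + 1 = 9 * x ∧
    2 * N (4 * l + 8) (2 * l + 2) + 1 = 9 * x ∧
    N (4 * l + 8) (2 * l + 3) = 9 * x ∧
    2 * N (4 * l + 8) (2 * l + 4) = 9 * x + 1 := by
  have a1 : N (4 * l + 5) (2 * l + 1) = _ := rec1 (n := 4 * l + 4) (p := 2 * l) (by omega) (by omega)
  have a2 : N (4 * l + 5) (2 * l + 2) = _ :=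
    rec1 (n := 4 * l + 4) (p := 2 * l + 1) (by omega) (by omega)
  have a3 : N (4 * l + 5) (2 * l + 3) = 0 := N_zero (by omega)
  have b1 : N (4 * l + 6) (2 * l + 1) = _ := rec1 (n := 4 * l + 5) (p := 2 * l) (by omega) (by omega)
  have b0 : N (4 * l + 5) (2 * l) = 0 := N_zero (by omega)
  have b2 : N (4 * l + 6) (2 * l + 2) = _ :=
    rec1 (n := 4 * l + 5) (p := 2 * l + 1) (by omega) (by omega)
  have b3 : N (4 * l + 6) (2 * l + 3) = _ :=
    rec1 (n := 4 * l + 5) (p := 2 * l + 2) (by omega) (by omega)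
  have c2 : N (4 * l + 7) (2 * l + 2) = _ :=
    rec1 (n := 4 * l + 6) (p := 2 * l + 1) (by omega) (by omega)
  have c3 : N (4 * l + 7) (2 * l + 3) = _ :=
    rec1 (n := 4 * l + 6) (p := 2 * l + 2) (by omega) (by omega)
  have c4 : N (4 * l + 7) (2 * l + 4) = 0 := N_zero (by omega)
  have c1 : N (4 * l + 7) (2 * l + 1) = 0 := N_zero (by omega)
  have d2 : N (4 * l + 8) (2 * l + 2) = _ :=
    rec1 (n := 4 * l + 7) (p := 2 * l + 1) (by omega) (by omega)
  have d3 : N (4 * l + 8) (2 * l + 3) = _ :=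
    rec1 (n := 4 * l + 7) (p := 2 * l + 2) (by omega) (by omega)
  have d4 : N (4 * l + 8) (2 * l + 4) = _ :=
    rec1 (n := 4 * l + 7) (p := 2 * l + 3) (by omega) (by omega)
  simp only [add_assoc, Nat.reduceAdd] at *
  omega

lemma row4 (l : ℕ) : 2 * N (4 * l + 4) (2 * l) + 1 = 3 ^ (2 * l + 1) ∧
    N (4 * l + 4) (2 * l + 1) = 3 ^ (2 * l + 1) ∧
    2 * N (4 * l + 4) (2 * l + 2) = 3 ^ (2 * l + 1) + 1 := by
  induction l with
  | zero =>
    obtain ⟨_, _, _, h4, h5, h6⟩ := base4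
    simp [h4, h5, h6]
  | succ l ih =>
    obtain ⟨_, _, _, h4, h5, h6⟩ := step l _ ih.1 ih.2.1 ih.2.2
    have e : 3 ^ (2 * (l + 1) + 1) = 9 * 3 ^ (2 * l + 1) := by ring
    rw [e]
    exact ⟨h4, h5, h6⟩

lemma rows (l : ℕ) : 2 * N (4 * l + 1) (2 * l) = 3 ^ (2 * l) + 1 ∧
    N (4 * l + 2) (2 * l) = 3 ^ (2 * l) ∧
    2 * N (4 * l + 3) (2 * l) + 1 = 3 ^ (2 * l + 1) := by
  cases l with
  | zero =>
    obtain ⟨h1, h2, h3, _⟩ := base4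
    simp [h1, h2, h3]
  | succ l =>
    obtain ⟨a, b, c⟩ := row4 l
    obtain ⟨h1, h2, h3, _⟩ := step l _ a b c
    have e : 3 ^ (2 * (l + 1) + 1) = 9 * 3 ^ (2 * l + 1) := by ring
    have e' : 3 ^ (2 * (l + 1)) = 3 * 3 ^ (2 * l + 1) := by ring
    rw [e, e']
    exact ⟨h1, h2, h3⟩

end EvInv

/-- Counts of even involutions avoiding 132 and 12345 of lengths
4l+1, 4l+2, 4l+3, 4l+4. -/
theorem even_involutions_avoiding_132_12345 (l : ℕ) :
    cntEven (4 * l + 1) = (3 ^ (2 * l) + 1) / 2 ∧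
    cntEven (4 * l + 2) = 3 ^ (2 * l) ∧
    cntEven (4 * l + 3) = (3 ^ (2 * l + 1) - 1) / 2 ∧
    cntEven (4 * l + 4) = 3 ^ (2 * l + 1) := by
  have he : Even (2 * l) := even_two_mul l
  have he' : Even (2 * l + 2) := by simp [Nat.even_add]
  rw [EvInv.cntEven_single (4 * l + 1) (2 * l) he (by rintro q ⟨r, rfl⟩; omega),
    EvInv.cntEven_single (4 * l + 2) (2 * l) he (by rintro q ⟨r, rfl⟩; omega),
    EvInv.cntEven_single (4 * l + 3) (2 * l) he (by rintro q ⟨r, rfl⟩; omega),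
    EvInv.cntEven_double (4 * l + 4) (2 * l) (2 * l + 2) he he' (by omega)
      (by rintro q ⟨r, rfl⟩; omega)]
  obtain ⟨a, b, c⟩ := EvInv.row4 l
  obtain ⟨h1, h2, h3⟩ := EvInv.rows l
  refine ⟨?_, h2, ?_, ?_⟩ <;> omega
end

section
/- The number of even involutions of length n that avoid the pattern 1234 and contain the pattern 132 exactly once equals fib(n−2) if n ≥ 5 and n ≡ 1 or 2 (mod 4) (i.e. n ∈ {5,6,9,10,13,14,…}), and equals 0 otherwise, where fib is the Fibonacci sequence with fib(0)=0, fib(1)=1 and fib(n)=fib(n−1)+fib(n−2). -/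
open Finset

/-- Number of even involutions of length n avoiding 1234 and containing 132
exactly once. -/
def cnt (n : ℕ) : ℕ :=
  (Finset.univ.filter (fun π : Equiv.Perm (Fin n) =>
    (∀ i, π (π i) = i) ∧ Even (inversions π) ∧ occ (1 : Equiv.Perm (Fin 4)) π = 0 ∧
      occ p132 π = 1)).card


/-- Avoidance of `1234`, unpacked. -/
def C4 {n : ℕ} (π : Equiv.Perm (Fin n)) : Prop :=
  ∀ a b c d : Fin n, a < b → b < c → c < d → π a < π b → π b < π c → π c < π d → False

/-- An occurrence of `132`, unpacked. -/
def O3 {n : ℕ} (π : Equiv.Perm (Fin n)) (a b c : Fin n) : Prop :=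
  a < b ∧ b < c ∧ π a < π c ∧ π c < π b

/-- The class of involutions being counted, without parity. -/
def Q {n : ℕ} (π : Equiv.Perm (Fin n)) : Prop :=
  (∀ i, π (π i) = i) ∧ C4 π ∧
    ∃ a b c, O3 π a b c ∧ ∀ a' b' c', O3 π a' b' c' → a' = a ∧ b' = b ∧ c' = c

/-- The last two entries form an ascent. -/
def H {n : ℕ} (π : Equiv.Perm (Fin n)) : Prop :=
  ∀ a b : Fin n, (a : ℕ) + 2 = n → (b : ℕ) + 1 = n → π a < π b

instance {n : ℕ} (π : Equiv.Perm (Fin n)) : Decidable (C4 π) := by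
  unfold C4; infer_instance

instance {n : ℕ} (π : Equiv.Perm (Fin n)) (a b c : Fin n) : Decidable (O3 π a b c) := by
  unfold O3; infer_instance

instance {n : ℕ} (π : Equiv.Perm (Fin n)) : Decidable (Q π) := by
  unfold Q; infer_instance

instance {n : ℕ} (π : Equiv.Perm (Fin n)) : Decidable (H π) := by
  unfold H; infer_instance

lemma occ4_iff {n : ℕ} (π : Equiv.Perm (Fin n)) :
    occ (1 : Equiv.Perm (Fin 4)) π = 0 ↔ C4 π := by
  unfold occ C4
  rw [Finset.card_eq_zero, Finset.filter_eq_empty_iff]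
  constructor
  · intro h a b c d hab hbc hcd h1 h2 h3
    apply h (Finset.mem_univ ![a, b, c, d])
    constructor
    · simp [Fin.forall_fin_succ]
      omega
    · simp [Fin.forall_fin_succ]
      omega
  · rintro h f - ⟨h1, h2⟩
    exact h (f 0) (f 1) (f 2) (f 3) (h1 _ _ (by decide)) (h1 _ _ (by decide)) (h1 _ _ (by decide))
      ((h2 _ _).1 (by decide)) ((h2 _ _).1 (by decide)) ((h2 _ _).1 (by decide))

lemma occ3_cond {n : ℕ} (π : Equiv.Perm (Fin n)) (f : Fin 3 → Fin n) :
    ((∀ a b : Fin 3, a < b → f a < f b) ∧ (∀ a b : Fin 3, p132 a < p132 b ↔ π (f a) < π (f b)))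
    ↔ O3 π (f 0) (f 1) (f 2) := by
  unfold O3
  constructor
  · rintro ⟨h1, h2⟩
    exact ⟨h1 _ _ (by decide), h1 _ _ (by decide), (h2 _ _).1 (by decide), (h2 _ _).1 (by decide)⟩
  · rintro ⟨h1, h2, h3, h4⟩
    have e0 : p132 0 = 0 := by decide
    have e1 : p132 1 = 2 := by decide
    have e2 : p132 2 = 1 := by decide
    constructor
    · simp [Fin.forall_fin_succ]
      omega
    · simp [Fin.forall_fin_succ, e0, e1, e2]
      omega

lemma occ3_iff {n : ℕ} (π : Equiv.Perm (Fin n)) :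
    occ p132 π = 1 ↔
      ∃ a b c, O3 π a b c ∧ ∀ a' b' c', O3 π a' b' c' → a' = a ∧ b' = b ∧ c' = c := by
  unfold occ
  simp only [occ3_cond]
  rw [Finset.card_eq_one]
  constructor
  · rintro ⟨f, hf⟩
    have h1 : f ∈ ({f} : Finset (Fin 3 → Fin n)) := by simp
    rw [← hf] at h1
    refine ⟨f 0, f 1, f 2, by simpa using h1, ?_⟩
    intro a b c h
    have h2 : ![a, b, c] ∈ ({f} : Finset (Fin 3 → Fin n)) := by
      rw [← hf]; simpa using h
    rw [Finset.mem_singleton] at h2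
    subst h2
    simp
  · rintro ⟨a, b, c, h, hu⟩
    refine ⟨![a, b, c], ?_⟩
    ext f
    simp only [Finset.mem_filter, Finset.mem_univ, true_and, Finset.mem_singleton]
    constructor
    · intro hf
      obtain ⟨e1, e2, e3⟩ := hu _ _ _ hf
      funext i
      fin_cases i <;> simp [e1, e2, e3]
    · rintro rfl
      simpa using h

lemma even_inv_iff {n : ℕ} (π : Equiv.Perm (Fin n)) :
    Even (inversions π) ↔ Equiv.Perm.sign π = 1 := by
  have h : Equiv.Perm.sign π = (-1) ^ inversions π := by
    rw [Equiv.Perm.sign_eq_prod_prod_Ioi, Finset.prod_sigma', inversions,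
      ← Finset.prod_const, ]
    rw [← Finset.prod_filter_mul_prod_filter_not _ (fun x => π x.1 < π x.2)]
    rw [Finset.prod_eq_one, one_mul]
    · refine Finset.prod_bij (fun x _ => (x.1, x.2)) ?_ ?_ ?_ ?_
      · rintro ⟨a, b⟩ h
        simp at h ⊢
        refine ⟨h.1, lt_of_le_of_ne h.2 ?_⟩
        intro h'
        exact h.1.ne' (π.injective h')
      · rintro ⟨a, b⟩ _ ⟨c, d⟩ _ h
        simpa using h
      · rintro ⟨a, b⟩ h
        refine ⟨⟨a, b⟩, ?_, rfl⟩
        simp at h ⊢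
        exact ⟨h.1, h.2.le⟩
      · rintro ⟨a, b⟩ h
        simp at h ⊢
        omega
    · rintro ⟨a, b⟩ h
      simp at h ⊢
      omega
  rw [h, neg_one_pow_eq_one_iff_even (by decide)]

/-- The embedding skipping `0` and `u + 1`. -/
def emb {n : ℕ} (u : Fin (n + 1)) : Fin n ↪ Fin (n + 2) :=
  ⟨fun i => (u.succAbove i).succ, fun i j h => by simpa using h⟩

lemma emb_apply {n : ℕ} (u : Fin (n + 1)) (i : Fin n) : emb u i = (u.succAbove i).succ := rfl

/-- Insert the two-cycle `(0, u+1)`. -/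
noncomputable def ins {n : ℕ} (u : Fin (n + 1)) (π : Equiv.Perm (Fin n)) :
    Equiv.Perm (Fin (n + 2)) :=
  Equiv.swap 0 u.succ * π.viaEmbedding (emb u)

lemma emb_lt {n : ℕ} (u : Fin (n + 1)) (i j : Fin n) : emb u i < emb u j ↔ i < j := by
  simp [emb_apply]

lemma emb_ne_zero {n : ℕ} (u : Fin (n + 1)) (i : Fin n) : emb u i ≠ 0 := by
  simp [emb_apply]

lemma emb_ne {n : ℕ} (u : Fin (n + 1)) (i : Fin n) : emb u i ≠ u.succ := by
  simp [emb_apply, Fin.succAbove_ne]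

lemma emb_surj {n : ℕ} (u : Fin (n + 1)) (x : Fin (n + 2)) (h0 : x ≠ 0) (h1 : x ≠ u.succ) :
    ∃ i, emb u i = x := by
  obtain ⟨y, rfl⟩ := Fin.exists_succ_eq.2 h0
  obtain ⟨i, rfl⟩ := Fin.exists_succAbove_eq (x := y) (y := u) (by rintro rfl; exact h1 rfl)
  exact ⟨i, rfl⟩

lemma ins_emb {n : ℕ} (u : Fin (n + 1)) (π : Equiv.Perm (Fin n)) (i : Fin n) :
    ins u π (emb u i) = emb u (π i) := by
  rw [ins, Equiv.Perm.mul_apply, Equiv.Perm.viaEmbedding_apply,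
    Equiv.swap_apply_of_ne_of_ne (emb_ne_zero _ _) (emb_ne _ _)]

lemma ins_zero {n : ℕ} (u : Fin (n + 1)) (π : Equiv.Perm (Fin n)) : ins u π 0 = u.succ := by
  rw [ins, Equiv.Perm.mul_apply, Equiv.Perm.viaEmbedding_apply_of_notMem, Equiv.swap_apply_left]
  rintro ⟨i, hi⟩
  exact emb_ne_zero _ _ hi

lemma ins_succ {n : ℕ} (u : Fin (n + 1)) (π : Equiv.Perm (Fin n)) : ins u π u.succ = 0 := by
  rw [ins, Equiv.Perm.mul_apply, Equiv.Perm.viaEmbedding_apply_of_notMem, Equiv.swap_apply_right]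
  rintro ⟨i, hi⟩
  exact emb_ne _ _ hi

lemma sign_ins {n : ℕ} (u : Fin (n + 1)) (π : Equiv.Perm (Fin n)) :
    Equiv.Perm.sign (ins u π) = - Equiv.Perm.sign π := by
  classical
  rw [ins, Equiv.Perm.sign_mul, Equiv.Perm.sign_swap (by simp [eq_comm]), Equiv.Perm.viaEmbedding,
    Equiv.Perm.sign_extendDomain]
  simp

lemma ins_inj {n : ℕ} (u : Fin (n + 1)) : Function.Injective (ins (n := n) u) := by
  intro π ρ h
  ext i : 1
  apply (emb u).injective
  rw [← ins_emb, h, ins_emb]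

lemma ins_surj {n : ℕ} (π : Equiv.Perm (Fin (n + 2))) (hinv : ∀ i, π (π i) = i) (h0 : π 0 ≠ 0) :
    ∃ u ρ, ins u ρ = π := by
  obtain ⟨u, hu⟩ := Fin.exists_succ_eq.2 h0
  have hu' : π u.succ = 0 := by rw [hu, hinv]
  have key : ∀ i : Fin n, ∃ j, emb u j = π (emb u i) := by
    intro i
    apply emb_surj
    · rw [← hu']; exact fun h => emb_ne _ _ (π.injective h)
    · rw [hu]; exact fun h => emb_ne_zero _ _ (π.injective h)
  choose f hf using key
  have hff : Function.Involutive f := by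
    intro i
    apply (emb u).injective
    rw [hf, hf, hinv]
  refine ⟨u, hff.toPerm, ?_⟩
  ext x : 1
  by_cases hx0 : x = 0
  · subst hx0; rw [ins_zero, hu]
  by_cases hx1 : x = u.succ
  · subst hx1; rw [ins_succ, hu']
  obtain ⟨i, rfl⟩ := emb_surj u x hx0 hx1
  rw [ins_emb, ← hf]; rfl

lemma O3_ins {n : ℕ} (u : Fin (n + 1)) (ρ : Equiv.Perm (Fin n)) (a b c : Fin n) :
    O3 (ins u ρ) (emb u a) (emb u b) (emb u c) ↔ O3 ρ a b c := by
  simp only [O3, ins_emb, emb_lt]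

lemma emb_val_lt {n : ℕ} (u : Fin (n + 1)) (i : Fin n) (h : (i : ℕ) < u) :
    ((emb u i : Fin (n + 2)) : ℕ) = i + 1 := by
  rw [emb_apply, Fin.succAbove_of_castSucc_lt _ _ (by simpa [Fin.lt_def] using h)]
  simp

lemma emb_val_ge {n : ℕ} (u : Fin (n + 1)) (i : Fin n) (h : (u : ℕ) ≤ i) :
    ((emb u i : Fin (n + 2)) : ℕ) = i + 2 := by
  rw [emb_apply, Fin.succAbove_of_le_castSucc _ _ (by simpa [Fin.le_def] using h)]
  simp

lemma inv_ins {n : ℕ} (u : Fin (n + 1)) (ρ : Equiv.Perm (Fin n)) :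
    (∀ i, ins u ρ (ins u ρ i) = i) ↔ ∀ i, ρ (ρ i) = i := by
  constructor
  · intro h i
    apply (emb u).injective
    rw [← ins_emb, ← ins_emb, h]
  · intro h x
    by_cases hx0 : x = 0
    · subst hx0; rw [ins_zero, ins_succ]
    by_cases hx1 : x = u.succ
    · subst hx1; rw [ins_succ, ins_zero]
    obtain ⟨i, rfl⟩ := emb_surj u x hx0 hx1
    rw [ins_emb, ins_emb, h]

/-- For `u = n - 2`, `H` transfers. -/
lemma H_ins_two {n : ℕ} (u : Fin (n + 1)) (hu : (u : ℕ) + 2 = n) (ρ : Equiv.Perm (Fin n)) :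
    H (ins u ρ) ↔ H ρ := by
  have h1 : n - 2 < n := by omega
  have h2 : n - 1 < n := by omega
  have e1 := emb_val_ge u ⟨n - 2, h1⟩ (by simp; omega)
  have e2 := emb_val_ge u ⟨n - 1, h2⟩ (by simp; omega)
  simp only at e1 e2
  constructor
  · intro h a b ha hb
    have := h (emb u ⟨n - 2, h1⟩) (emb u ⟨n - 1, h2⟩) (by omega) (by omega)
    rw [ins_emb, ins_emb, emb_lt] at this
    convert this using 2 <;> ext <;> simp <;> omega
  · intro h a b ha hb
    have ea : a = emb u ⟨n - 2, h1⟩ := by ext; omega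
    have eb : b = emb u ⟨n - 1, h2⟩ := by ext; omega
    rw [ea, eb, ins_emb, ins_emb, emb_lt]
    apply h <;> simp <;> omega

lemma Q_ins_of {n : ℕ} (u : Fin (n + 1)) (ρ : Equiv.Perm (Fin n)) (hQ : Q ρ)
    (hu : n ≤ (u : ℕ) + 2) (hH : (u : ℕ) + 2 = n → H (ins u ρ)) : Q (ins u ρ) := by
  obtain ⟨hinv, h4, a, b, c, h3, huniq⟩ := hQ
  have hinv' := (inv_ins u ρ).2 hinv
  set π := ins u ρ with hπ
  have p0 : π 0 = u.succ := ins_zero u ρ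
  have pu : π u.succ = 0 := ins_succ u ρ
  -- nothing with first entry at position `0` or `u + 1`
  have no0 : ∀ y z : Fin (n + 2), y < z → π 0 < π y → π 0 < π z → π y < π z := by
    intro y z hyz h1 h2
    by_contra hlt
    have hlt' : π z < π y := lt_of_le_of_ne (not_lt.1 hlt) (fun h => hyz.ne' (π.injective h))
    rw [p0] at h1 h2
    simp only [Fin.lt_def, Fin.val_succ] at h1 h2 hlt'
    have b1 := (π y).2
    have := hH (by omega) (π z) (π y) (by omega) (by omega)
    rw [hinv', hinv'] at this
    exact absurd this (not_lt.2 hyz.le)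
  have nou : ∀ y z : Fin (n + 2), u.succ < y → y < z → π y < π z := by
    intro y z h1 h2
    simp only [Fin.lt_def, Fin.val_succ] at h1 h2
    exact hH (by omega) y z (by omega) (by omega)
  refine ⟨hinv', ?_, emb u a, emb u b, emb u c, (O3_ins _ _ _ _ _).2 h3, ?_⟩
  · intro x y z w hxy hyz hzw l1 l2 l3
    have hy0 : y ≠ 0 := by rintro rfl; simp at hxy
    have hz0 : z ≠ 0 := by rintro rfl; simp at hyz
    have hw0 : w ≠ 0 := by rintro rfl; simp at hzw
    have hyu : y ≠ u.succ := by rintro rfl; rw [pu] at l1; simp at l1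
    have hzu : z ≠ u.succ := by rintro rfl; rw [pu] at l2; simp at l2
    have hwu : w ≠ u.succ := by rintro rfl; rw [pu] at l3; simp at l3
    have hx0 : x ≠ 0 := by
      rintro rfl
      rw [p0] at l1
      have := (π w).2
      simp only [Fin.lt_def, Fin.val_succ] at l1 l2 l3
      omega
    have hxu : x ≠ u.succ := by
      rintro rfl
      have := w.2
      simp only [Fin.lt_def, Fin.val_succ] at hxy hyz hzw
      omega
    obtain ⟨x, rfl⟩ := emb_surj u x hx0 hxu
    obtain ⟨y, rfl⟩ := emb_surj u y hy0 hyu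
    obtain ⟨z, rfl⟩ := emb_surj u z hz0 hzu
    obtain ⟨w, rfl⟩ := emb_surj u w hw0 hwu
    simp only [hπ, ins_emb, emb_lt] at *
    exact h4 x y z w hxy hyz hzw l1 l2 l3
  · intro x y z h
    obtain ⟨hxy, hyz, l1, l2⟩ := id h
    have hy0 : y ≠ 0 := by rintro rfl; simp at hxy
    have hz0 : z ≠ 0 := by rintro rfl; simp at hyz
    have hyu : y ≠ u.succ := by rintro rfl; rw [pu] at l2; simp at l2
    have hzu : z ≠ u.succ := by rintro rfl; rw [pu] at l1; simp at l1
    have hx0 : x ≠ 0 := by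
      rintro rfl
      exact absurd (no0 y z hyz (l1.trans l2) l1) (not_lt.2 l2.le)
    have hxu : x ≠ u.succ := by
      rintro rfl
      exact absurd (nou y z hxy hyz) (not_lt.2 l2.le)
    obtain ⟨x, rfl⟩ := emb_surj u x hx0 hxu
    obtain ⟨y, rfl⟩ := emb_surj u y hy0 hyu
    obtain ⟨z, rfl⟩ := emb_surj u z hz0 hzu
    obtain ⟨r1, r2, r3⟩ := huniq x y z ((O3_ins _ _ _ _ _).1 h)
    rw [r1, r2, r3]
    exact ⟨rfl, rfl, rfl⟩

lemma Q_decomp {n : ℕ} (hn : 3 ≤ n) (π : Equiv.Perm (Fin (n + 2))) (hQ : Q π) :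
    ∃ u ρ, ins u ρ = π ∧ Q ρ ∧ n ≤ (u : ℕ) + 2 ∧ ((u : ℕ) + 2 = n → H π) := by
  obtain ⟨hinv, h4, i, j, k, h3, huniq⟩ := hQ
  obtain ⟨hij, hjk, l1, l2⟩ := id h3
  have hsym : π i = i ∧ π k = j ∧ π j = k := by
    apply huniq
    refine ⟨l1, l2, ?_, ?_⟩ <;> simpa only [hinv]
  obtain ⟨pi, pk, pj⟩ := hsym
  have hi0 : i ≠ 0 := by
    rintro rfl
    have key : ∀ a b c : Fin (n + 2), 0 < a → a < b → b < c →
        (a = j ∧ b = k) ∨ (b = j ∧ c = k) := by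
      intro a b c h0 hab hbc
      have pos : ∀ x : Fin (n + 2), 0 < x → π 0 < π x := by
        intro x hx
        rw [pi, Fin.pos_iff_ne_zero]
        intro h
        rw [← pi] at h
        exact hx.ne' (π.injective h)
      by_contra hcon
      push Not at hcon
      have h1 : π a < π b := by
        rcases lt_trichotomy (π a) (π b) with h | h | h
        · exact h
        · exact absurd (π.injective h) hab.ne
        · have := huniq 0 a b ⟨h0, hab, pos _ (h0.trans hab), h⟩
          exact absurd this.2.2 (hcon.1 this.2.1)
      have h2 : π b < π c := by
        rcases lt_trichotomy (π b) (π c) with h | h | h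
        · exact h
        · exact absurd (π.injective h) hbc.ne
        · have := huniq 0 b c ⟨h0.trans hab, hbc, pos _ ((h0.trans hab).trans hbc), h⟩
          exact absurd this.2.2 (hcon.2 this.2.1)
      exact h4 0 a b c h0 hab hbc (pos _ h0) h1 h2
    have k1 := key ⟨1, by omega⟩ ⟨2, by omega⟩ ⟨4, by omega⟩ (by simp [Fin.lt_def])
      (by simp [Fin.lt_def]) (by simp [Fin.lt_def])
    have k2 := key ⟨1, by omega⟩ ⟨3, by omega⟩ ⟨4, by omega⟩ (by simp [Fin.lt_def])
      (by simp [Fin.lt_def]) (by simp [Fin.lt_def])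
    simp only [Fin.ext_iff] at k1 k2
    omega
  have hpos : 0 < i := Fin.pos_iff_ne_zero.2 hi0
  have hj0 : j ≠ 0 := (hpos.trans hij).ne'
  have hk0 : k ≠ 0 := ((hpos.trans hij).trans hjk).ne'
  have h00 : π 0 ≠ 0 := by
    intro h
    have := huniq 0 j k ⟨hpos.trans hij, hjk, by rw [h, pk]; exact hpos.trans hij, l2⟩
    exact hi0 this.1.symm
  obtain ⟨u, ρ, rfl⟩ := ins_surj π hinv h00
  -- large entries are increasing
  have inc : ∀ x y : Fin (n + 2), u.succ < x → x < y → ins u ρ x < ins u ρ y := by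
    intro x y hx hxy
    rcases lt_trichotomy (ins u ρ x) (ins u ρ y) with h | h | h
    · exact h
    · exact absurd ((ins u ρ).injective h) hxy.ne
    · exfalso
      have hy0 : 0 < ins u ρ y := by
        rw [Fin.pos_iff_ne_zero, ← ins_succ u ρ]
        intro h'
        have := (ins u ρ).injective h'
        rw [this] at hxy
        exact absurd (hx.trans hxy) (lt_irrefl _)
      have := huniq 0 (ins u ρ y) (ins u ρ x)
        ⟨hy0, h, by rw [ins_zero, hinv]; exact hx, by rw [hinv, hinv]; exact hxy⟩
      exact hi0 this.1.symm
  refine ⟨u, ρ, rfl, ⟨(inv_ins u ρ).1 hinv, ?_, ?_⟩, ?_, ?_⟩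
  · intro a b c d h1 h2 h3 e1 e2 e3
    refine h4 (emb u a) (emb u b) (emb u c) (emb u d) ?_ ?_ ?_ ?_ ?_ ?_ <;>
      simpa only [ins_emb, emb_lt]
  · have aux : ∀ x y : Fin (n + 2), ins u ρ x = y → y ≠ 0 → x ≠ u.succ := by
      rintro x y h hy rfl
      rw [ins_succ] at h
      exact hy h.symm
    obtain ⟨a, rfl⟩ := emb_surj u i hi0 (aux _ _ pi hi0)
    obtain ⟨b, rfl⟩ := emb_surj u j hj0 (aux _ _ pj hk0)
    obtain ⟨c, rfl⟩ := emb_surj u k hk0 (aux _ _ pk hj0)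
    refine ⟨a, b, c, (O3_ins _ _ _ _ _).1 h3, ?_⟩
    intro a' b' c' h'
    obtain ⟨r1, r2, r3⟩ := huniq _ _ _ ((O3_ins u _ _ _ _).2 h')
    exact ⟨(emb u).injective r1, (emb u).injective r2, (emb u).injective r3⟩
  · by_contra hlt
    have c1 : (u : ℕ) + 2 < n + 2 := by omega
    have c2 : (u : ℕ) + 3 < n + 2 := by omega
    have c3 : (u : ℕ) + 4 < n + 2 := by omega
    have s1 := inc ⟨_, c1⟩ ⟨_, c2⟩ (by simp [Fin.lt_def]) (by simp [Fin.lt_def])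
    have s2 := inc ⟨_, c2⟩ ⟨_, c3⟩ (by simp [Fin.lt_def]) (by simp [Fin.lt_def])
    refine h4 0 _ _ _ ?_ s1 s2 ?_ ?_ ?_
    · rw [Fin.pos_iff_ne_zero, ← ins_succ u ρ]
      intro h'
      have := (ins u ρ).injective h'
      simp [Fin.ext_iff] at this
    · rw [ins_zero, hinv]; simp [Fin.lt_def]
    · rw [hinv, hinv]; simp [Fin.lt_def]
    · rw [hinv, hinv]; simp [Fin.lt_def]
  · intro hu a b ha hb
    apply inc
    · simp only [Fin.lt_def, Fin.val_succ]; omega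
    · simp only [Fin.lt_def]; omega

/-- The counted finset without parity. -/
def P (n : ℕ) : Finset (Equiv.Perm (Fin n)) := Finset.univ.filter Q

/-- The part of `P n` with a final ascent. -/
def PH (n : ℕ) : Finset (Equiv.Perm (Fin n)) := Finset.univ.filter (fun π => Q π ∧ H π)

lemma mem_P {n : ℕ} (π : Equiv.Perm (Fin n)) : π ∈ P n ↔ Q π := by simp [P]

lemma mem_PH {n : ℕ} (π : Equiv.Perm (Fin n)) : π ∈ PH n ↔ Q π ∧ H π := by simp [PH]

lemma not_H_last {n : ℕ} (ρ : Equiv.Perm (Fin n)) : ¬ H (ins (Fin.last n) ρ) := by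
  intro h
  have := h ⟨n, by omega⟩ ⟨n + 1, by omega⟩ rfl rfl
  have e : (⟨n + 1, by omega⟩ : Fin (n + 2)) = (Fin.last n).succ := rfl
  rw [e, ins_succ] at this
  simp at this

lemma H_mid {n : ℕ} (u : Fin (n + 1)) (hu : (u : ℕ) + 1 = n) (ρ : Equiv.Perm (Fin n)) :
    H (ins u ρ) := by
  intro a b ha hb
  have e : a = u.succ := by ext; simp; omega
  rw [e, ins_succ, Fin.pos_iff_ne_zero, ← ins_succ u ρ]
  intro h
  have := (ins u ρ).injective h
  simp [Fin.ext_iff] at this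
  omega

lemma P_succ {n : ℕ} (hn : 3 ≤ n) (u1 u2 : Fin (n + 1)) (h1 : (u1 : ℕ) + 1 = n)
    (h2 : (u2 : ℕ) + 2 = n) :
    P (n + 2) = ((P n).image (ins (Fin.last n)) ∪ (P n).image (ins u1)) ∪ (PH n).image (ins u2) := by
  ext π
  simp only [Finset.mem_union, Finset.mem_image, mem_P, mem_PH]
  constructor
  · intro h
    obtain ⟨u, ρ, rfl, hQ, hu, hH⟩ := Q_decomp hn π h
    have hu' := u.2
    have : (u : ℕ) = n ∨ (u : ℕ) + 1 = n ∨ (u : ℕ) + 2 = n := by omega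
    rcases this with hh | hh | hh
    · obtain rfl : u = Fin.last n := by ext; simpa using hh
      exact Or.inl (Or.inl ⟨ρ, hQ, rfl⟩)
    · obtain rfl : u = u1 := by ext; omega
      exact Or.inl (Or.inr ⟨ρ, hQ, rfl⟩)
    · obtain rfl : u = u2 := by ext; omega
      exact Or.inr ⟨ρ, ⟨hQ, (H_ins_two u hh ρ).1 (hH hh)⟩, rfl⟩
  · rintro ((⟨ρ, hQ, rfl⟩ | ⟨ρ, hQ, rfl⟩) | ⟨ρ, ⟨hQ, hH⟩, rfl⟩)
    · exact Q_ins_of _ _ hQ (by simp) (by simp)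
    · exact Q_ins_of _ _ hQ (by omega) (by omega)
    · exact Q_ins_of _ _ hQ (by omega) (fun _ => (H_ins_two u2 h2 ρ).2 hH)

lemma PH_succ {n : ℕ} (hn : 3 ≤ n) (u1 u2 : Fin (n + 1)) (h1 : (u1 : ℕ) + 1 = n)
    (h2 : (u2 : ℕ) + 2 = n) :
    PH (n + 2) = (P n).image (ins u1) ∪ (PH n).image (ins u2) := by
  ext π
  rw [mem_PH, ← mem_P, P_succ hn u1 u2 h1 h2]
  simp only [Finset.mem_union, Finset.mem_image, mem_P, mem_PH]
  constructor
  · rintro ⟨(⟨ρ, hQ, rfl⟩ | h) | h, hH⟩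
    · exact absurd hH (not_H_last ρ)
    · exact Or.inl h
    · exact Or.inr h
  · rintro (⟨ρ, hQ, rfl⟩ | ⟨ρ, ⟨hQ, hH⟩, rfl⟩)
    · exact ⟨Or.inl (Or.inr ⟨ρ, hQ, rfl⟩), H_mid u1 h1 ρ⟩
    · exact ⟨Or.inr ⟨ρ, ⟨hQ, hH⟩, rfl⟩, (H_ins_two u2 h2 ρ).2 hH⟩

lemma disj_image {n : ℕ} (u v : Fin (n + 1)) (h : u ≠ v) (A B : Finset (Equiv.Perm (Fin n))) :
    Disjoint (A.image (ins u)) (B.image (ins v)) := by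
  rw [Finset.disjoint_left]
  intro π hA hB
  obtain ⟨a, -, rfl⟩ := Finset.mem_image.1 hA
  obtain ⟨b, -, hb⟩ := Finset.mem_image.1 hB
  have := ins_zero u a
  rw [← hb, ins_zero] at this
  exact h (Fin.succ_injective _ this).symm

lemma card_rec {n : ℕ} (hn : 3 ≤ n) :
    (P (n + 2)).card = 2 * (P n).card + (PH n).card ∧
    (PH (n + 2)).card = (P n).card + (PH n).card := by
  have d1 : Fin.last n ≠ (⟨n - 1, by omega⟩ : Fin (n + 1)) := by
    simp [Fin.ext_iff]; omega
  have d2 : Fin.last n ≠ (⟨n - 2, by omega⟩ : Fin (n + 1)) := by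
    simp [Fin.ext_iff]; omega
  have d3 : (⟨n - 1, by omega⟩ : Fin (n + 1)) ≠ ⟨n - 2, by omega⟩ := by
    simp [Fin.ext_iff]; omega
  constructor
  · rw [P_succ hn ⟨n - 1, by omega⟩ ⟨n - 2, by omega⟩ (by simp; omega) (by simp; omega),
      Finset.card_union_of_disjoint, Finset.card_union_of_disjoint (disj_image _ _ d1 _ _),
      Finset.card_image_of_injective _ (ins_inj _), Finset.card_image_of_injective _ (ins_inj _),
      Finset.card_image_of_injective _ (ins_inj _)]
    · ring
    · rw [Finset.disjoint_union_left]
      exact ⟨disj_image _ _ d2 _ _, disj_image _ _ d3 _ _⟩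
  · rw [PH_succ hn ⟨n - 1, by omega⟩ ⟨n - 2, by omega⟩ (by simp; omega) (by simp; omega),
      Finset.card_union_of_disjoint (disj_image _ _ d3 _ _),
      Finset.card_image_of_injective _ (ins_inj _), Finset.card_image_of_injective _ (ins_inj _)]

lemma card_fib : ∀ n : ℕ, (P (n + 3)).card = Nat.fib (n + 1) ∧ (PH (n + 3)).card = Nat.fib n
  | 0 => by decide +kernel
  | 1 => by decide +kernel
  | n + 2 => by
    obtain ⟨h1, h2⟩ := card_fib n
    obtain ⟨r1, r2⟩ := card_rec (n := n + 3) (by omega)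
    have e : n + 2 + 3 = n + 3 + 2 := by omega
    rw [e, r1, r2, h1, h2]
    have f1 : Nat.fib (n + 2) = Nat.fib n + Nat.fib (n + 1) := Nat.fib_add_two
    have f2 : Nat.fib (n + 2 + 1) = Nat.fib (n + 1) + Nat.fib (n + 2) := Nat.fib_add_two
    omega

/-- All members of `P (n+3)` have the same sign. -/
lemma sign_P : ∀ n : ℕ, ∀ π : Equiv.Perm (Fin (n + 3)), Q π →
    Equiv.Perm.sign π = (-1) ^ (n / 2 + 1)
  | 0 => by decide +kernel
  | 1 => by decide +kernel
  | n + 2 => by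
    intro π hQ
    obtain ⟨u, ρ, h, hQ', -, -⟩ := Q_decomp (n := n + 3) (by omega) π hQ
    have := sign_P n ρ hQ'
    have e : (n + 2) / 2 + 1 = n / 2 + 1 + 1 := by omega
    rw [← h, sign_ins, this, e, pow_succ _ (n / 2 + 1)]
    simp

lemma cnt_eq (n : ℕ) : cnt n = ((P n).filter (fun π => Equiv.Perm.sign π = 1)).card := by
  unfold cnt P
  rw [Finset.filter_filter]
  congr 1
  apply Finset.filter_congr
  intro π _
  rw [even_inv_iff, occ4_iff, occ3_iff]
  unfold Q
  tauto

lemma P_small {n : ℕ} (hn : n < 3) : P n = ∅ := by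
  rw [Finset.eq_empty_iff_forall_notMem]
  intro π h
  obtain ⟨-, -, a, b, c, ⟨h1, h2, -, -⟩, -⟩ := (mem_P π).1 h
  have := c.2
  simp only [Fin.lt_def] at h1 h2
  omega

/-- The count equals fib(n−2) if n ≥ 5 and n ≡ 1 or 2 (mod 4), else 0. -/
theorem even_involutions_avoiding_1234_containing_132_once (n : ℕ) :
    cnt n = if 5 ≤ n ∧ (n % 4 = 1 ∨ n % 4 = 2) then Nat.fib (n - 2) else 0 := by

  rw [cnt_eq]
  rcases lt_or_ge n 3 with h | h
  · rw [P_small h, if_neg (by omega)]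
    rfl
  · obtain ⟨m, rfl⟩ : ∃ m, n = m + 3 := ⟨n - 3, by omega⟩
    by_cases hm : Even (m / 2 + 1)
    · have hp : 5 ≤ m + 3 ∧ ((m + 3) % 4 = 1 ∨ (m + 3) % 4 = 2) := by
        rw [Nat.even_iff] at hm
        omega
      rw [if_pos hp, Finset.filter_true_of_mem, (card_fib m).1]
      · congr 1
      · intro π hπ
        rw [sign_P m π ((mem_P π).1 hπ), hm.neg_one_pow]
    · have hp : ¬ (5 ≤ m + 3 ∧ ((m + 3) % 4 = 1 ∨ (m + 3) % 4 = 2)) := by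
        rw [Nat.even_iff] at hm
        omega
      rw [if_neg hp, Finset.filter_false_of_mem, Finset.card_empty]
      intro π hπ
      rw [sign_P m π ((mem_P π).1 hπ), (Nat.not_even_iff_odd.1 hm).neg_one_pow]
      decide
end
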